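/- Let g be a semisimple Lie algebra, {e,h,f} a principal sl₂-triple with h in a Cartan subalgebra t and e = Σ_{α∈Π} c_α e_α (c_α ≠ 0), f = Σ_{α∈Π} e_{−α}. Let ν be a simple root and h' ∈ H_ν = {x ∈ t : ν(x) = 0} a generic point of the reflection hyperplane (i.e. h' lies on no other reflection hyperplane). Then for every nonzero scalar s, the element h' + s·f is regular in g and its centralizer satisfies g^{h'+sf} ⊆ H_ν ⊕ u⁻, where u⁻ is the sum of the negative root spaces. -/

import Mathlib

namespace PoissonLie

variable {k : Type*} [Field k] [CharZero k] [IsAlgClosed k]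
variable {q : Type*} [LieRing q] [LieAlgebra k q]

open LieAlgebra

/-- Induction over a finite set whose order is generated by adding elements of `B`: it is well founded
as soon as some additive functional takes a constant nonzero value on `B`. -/
theorem finset_add_induction {R : Type*} [Field R] [CharZero R] {V : Type*} [AddCommGroup V]
    (S B : Finset V) (φ : V →+ R) {c : R}
    (hc : c ≠ 0) (hφ : ∀ β ∈ B, φ β = c) {P : V → Prop}
    (step : ∀ α ∈ S, (∀ β ∈ B, α + β ∈ S → P (α + β)) → P α) : ∀ α ∈ S, P α := by
  let r : S → S → Prop := fun a b ↦ ∃ n : ℕ, φ a = φ b + ((n + 1 : ℕ) : R) * c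
  have : Std.Irrefl r := ⟨by
    rintro a ⟨n, hn⟩
    have : ((n + 1 : ℕ) : R) ≠ 0 := Nat.cast_ne_zero.mpr n.succ_ne_zero
    simp_all⟩
  have : IsTrans S r := ⟨by
    rintro a b d ⟨n, hn⟩ ⟨m, hm⟩
    refine ⟨n + m + 1, ?_⟩
    rw [hn, hm]
    push_cast
    ring⟩
  have wf : WellFounded r := Finite.wellFounded_of_trans_of_irrefl r
  suffices ∀ a : S, P a from fun α hα ↦ this ⟨α, hα⟩
  intro a
  induction a using wf.induction with
  | _ a ih =>
    refine step a a.2 fun β hβ hmem ↦ ih ⟨_, hmem⟩ ⟨0, ?_⟩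
    simp [hφ β hβ]

section RootSpaces

variable [FiniteDimensional k q] (t : LieSubalgebra k q) [t.IsCartanSubalgebra]

theorem iSup_rootSpace_dual_eq_top :
    ⨆ γ : Module.Dual k t, (rootSpace t ⇑γ).toSubmodule = ⊤ := by
  rw [eq_top_iff, ← LieSubmodule.iSup_toSubmodule_eq_top.mpr
    (LieModule.iSup_genWeightSpace_eq_top' k t q)]
  exact iSup_le fun χ ↦ le_iSup (fun γ : Module.Dual k t ↦ (rootSpace t ⇑γ).toSubmodule)
    χ.toLinear

theorem iSupIndep_rootSpace_dual :
    iSupIndep fun γ : Module.Dual k t ↦ (rootSpace t ⇑γ).toSubmodule :=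
  (LieSubmodule.iSupIndep_toSubmodule.mpr (LieModule.iSupIndep_genWeightSpace k t q)).comp
    DFunLike.coe_injective

open Classical in
/-- The root space decomposition, indexed by all linear functionals on the Cartan subalgebra. -/
@[reducible]
noncomputable def rootDecomposition :
    DirectSum.Decomposition fun γ : Module.Dual k t ↦ (rootSpace t ⇑γ).toSubmodule :=
  (DirectSum.isInternal_submodule_of_iSupIndep_of_iSup_eq_top (iSupIndep_rootSpace_dual t)
    (iSup_rootSpace_dual_eq_top t)).chooseDecomposition

open Classical in
/-- The projection onto a root space along the other ones. -/
noncomputable def rootProj (γ : Module.Dual k t) : q →ₗ[k] q :=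
  letI := rootDecomposition t
  (rootSpace t ⇑γ).toSubmodule.subtype ∘ₗ DirectSum.component k _ _ γ ∘ₗ
    (DirectSum.decomposeLinearEquiv
      fun γ : Module.Dual k t ↦ (rootSpace t ⇑γ).toSubmodule).toLinearMap

variable {t}

theorem rootProj_mem (γ : Module.Dual k t) (x : q) : rootProj t γ x ∈ rootSpace t ⇑γ := by
  simp only [rootProj, LinearMap.comp_apply, Submodule.subtype_apply]
  exact Subtype.property _

theorem rootProj_of_mem {γ : Module.Dual k t} {x : q} (hx : x ∈ rootSpace t ⇑γ) :
    rootProj t γ x = x := by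
  classical
  let := rootDecomposition t
  exact DirectSum.decompose_of_mem_same
    (fun γ : Module.Dual k t ↦ (rootSpace t ⇑γ).toSubmodule) hx

theorem rootProj_of_mem_ne {γ δ : Module.Dual k t} {x : q} (hx : x ∈ rootSpace t ⇑δ)
    (h : δ ≠ γ) : rootProj t γ x = 0 := by
  classical
  let := rootDecomposition t
  exact DirectSum.decompose_of_mem_ne
    (fun γ : Module.Dual k t ↦ (rootSpace t ⇑γ).toSubmodule) hx h

theorem mem_of_rootProj_mem {N : Submodule k q} {x : q}
    (h : ∀ γ : Module.Dual k t, rootProj t γ x ∈ N) : x ∈ N := by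
  classical
  let := rootDecomposition t
  rw [← DirectSum.sum_support_decompose
    (fun γ : Module.Dual k t ↦ (rootSpace t ⇑γ).toSubmodule) x]
  exact sum_mem fun γ _ ↦ h γ

theorem rootProj_lie {γ δ : Module.Dual k t} {x : q} (hx : x ∈ rootSpace t ⇑δ) (y : q) :
    rootProj t (γ + δ) ⁅x, y⁆ = ⁅x, rootProj t γ y⁆ := by
  have hy : y ∈ ⨆ γ : Module.Dual k t, (rootSpace t ⇑γ).toSubmodule := by
    simp [iSup_rootSpace_dual_eq_top]
  induction hy using Submodule.iSup_induction' with
  | mem ε y hy =>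
    have hxy : ⁅x, y⁆ ∈ rootSpace t ⇑(ε + δ) := by
      rw [add_comm]
      exact lie_mem_genWeightSpace_of_mem_genWeightSpace hx hy
    by_cases h : ε = γ
    · subst h
      rw [rootProj_of_mem hxy, rootProj_of_mem hy]
    · rw [rootProj_of_mem_ne hxy (by simpa using h), rootProj_of_mem_ne hy h, lie_zero]
  | zero => simp
  | add y z _ _ hy hz => simp [hy, hz]

theorem rootProj_eq_zero_of_eq_bot {γ : Module.Dual k t} (h : rootSpace t ⇑γ = ⊥) (y : q) :
    rootProj t γ y = 0 := by
  simpa [h] using rootProj_mem γ y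

theorem rootProj_neg_sum {S : Finset (Module.Dual k t)} {F : Module.Dual k t → q}
    (hF : ∀ α ∈ S, F α ∈ rootSpace t ⇑(-α)) {α : Module.Dual k t} (hα : α ∈ S) :
    rootProj t (-α) (∑ β ∈ S, F β) = F α := by
  rw [map_sum, Finset.sum_eq_single_of_mem α hα, rootProj_of_mem (hF α hα)]
  exact fun β hβ hne ↦ rootProj_of_mem_ne (hF β hβ) (by simpa using hne)

theorem coe_mem_rootSpace_zero (h : t) : (h : q) ∈ rootSpace t ⇑(0 : Module.Dual k t) :=
  toLieSubmodule_le_rootSpace_zero k q t h.2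

theorem mem_of_mem_rootSpace_zero {x : q} (hx : x ∈ rootSpace t ⇑(0 : Module.Dual k t)) :
    x ∈ t := by
  have h : x ∈ rootSpace t (0 : t → k) := hx
  rw [rootSpace_zero_eq] at h
  exact h

variable [IsKilling k q]

theorem lie_eq_smul_of_mem_rootSpace_dual {γ : Module.Dual k t} {x : q}
    (hx : x ∈ rootSpace t ⇑γ) (h : t) : ⁅(h : q), x⁆ = γ h • x :=
  IsKilling.lie_eq_smul_of_mem_rootSpace hx h

theorem rootSpace_neg_ne_bot {γ : Module.Dual k t} (h : rootSpace t ⇑γ ≠ ⊥) :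
    rootSpace t ⇑(-γ) ≠ ⊥ :=
  (-(⟨⇑γ, h⟩ : LieModule.Weight k t q)).genWeightSpace_ne_bot

/-- Root spaces are lines. -/
theorem exists_eq_smul_of_mem_rootSpace {γ : Module.Dual k t} (hγ : γ ≠ 0) {x y : q}
    (hx : x ∈ rootSpace t ⇑γ) (hx0 : x ≠ 0) (hy : y ∈ rootSpace t ⇑γ) : ∃ c : k, y = c • x := by
  have hbot : rootSpace t ⇑γ ≠ ⊥ := fun h ↦ hx0 (by simpa [h] using hx)
  have h1 := IsKilling.finrank_rootSpace_eq_one (⟨⇑γ, hbot⟩ : LieModule.Weight k t q)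
    (fun h ↦ hγ (DFunLike.coe_injective h))
  obtain ⟨c, hc⟩ := exists_smul_eq_of_finrank_eq_one h1
    (x := (⟨x, hx⟩ : rootSpace t ⇑γ)) (fun h ↦ hx0 (by simpa using h)) ⟨y, hy⟩
  exact ⟨c, by simpa using congrArg Subtype.val hc.symm⟩

theorem lie_ne_zero_of_mem_rootSpace_neg {γ : Module.Dual k t} (hγ : γ ≠ 0) {x y : q}
    (hx : x ∈ rootSpace t ⇑γ) (hx0 : x ≠ 0) (hy : y ∈ rootSpace t ⇑(-γ)) (hy0 : y ≠ 0) :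
    ⁅x, y⁆ ≠ 0 := by
  have hbot : rootSpace t ⇑γ ≠ ⊥ := fun h ↦ hx0 (by simpa [h] using hx)
  let χ : LieModule.Weight k t q := ⟨⇑γ, hbot⟩
  have hχ : χ.toLinear = γ := rfl
  have key := IsKilling.lie_eq_killingForm_smul_of_mem_rootSpace_of_mem_rootSpace_neg
    (α := χ) hx hy
  rw [hχ] at key
  intro h0
  have h1 : killingForm k q x y ≠ 0 := by
    intro hκ
    have := mem_ker_killingForm_of_mem_rootSpace_of_forall_rootSpace_neg k q t hx (fun z hz ↦ by
      obtain ⟨c, rfl⟩ := exists_eq_smul_of_mem_rootSpace (neg_ne_zero.mpr hγ) hy hy0 hz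
      simp [hκ])
    rw [IsKilling.ker_killingForm_eq_bot] at this
    exact hx0 (by simpa using this)
  have h2 : (((IsKilling.cartanEquivDual t).symm γ : t) : q) ≠ 0 := by
    simpa using hγ
  rw [h0] at key
  exact smul_ne_zero h1 h2 key.symm

theorem rootProj_coe_lie (γ : Module.Dual k t) (h : t) (y : q) :
    rootProj t γ ⁅(h : q), y⁆ = γ h • rootProj t γ y := by
  have := rootProj_lie (γ := γ) (coe_mem_rootSpace_zero h) y
  rw [add_zero] at this
  rw [this, lie_eq_smul_of_mem_rootSpace_dual (rootProj_mem γ y)]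

theorem rootProj_lie_add_smul_sum {S : Finset (Module.Dual k t)} {F : Module.Dual k t → q}
    (hF : ∀ α ∈ S, F α ∈ rootSpace t ⇑(-α)) (h : t) (s : k) (γ : Module.Dual k t) (y : q) :
    rootProj t γ ⁅(h : q) + s • ∑ α ∈ S, F α, y⁆ =
      γ h • rootProj t γ y + s • ∑ α ∈ S, ⁅F α, rootProj t (γ + α) y⁆ := by
  rw [add_lie, map_add, rootProj_coe_lie, smul_lie, map_smul, sum_lie, map_sum]
  congr 2
  refine Finset.sum_congr rfl fun α hα ↦ ?_
  have := rootProj_lie (γ := γ + α) (hF α hα) y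
  rwa [add_neg_cancel_right] at this

end RootSpaces

/-- Lemma 3.3: let `{e,h,f}` be a principal `sl₂`-triple with `h ∈ t`,
`e = Σ_{α∈Π} c_α e_α` and `f = Σ_{α∈Π} e_{-α}`, `ν` a simple root, and `h' ∈ H_ν` generic.
Then for every `s ≠ 0` the element `h' + s·f` is regular (its centralizer has dimension
`rk g`) and `g^{h'+sf} ⊆ H_ν ⊕ u⁻`. -/
theorem centralizer_subset_hyperplane_sup_negative_nilradical
    [FiniteDimensional k q] [LieAlgebra.IsSemisimple k q]
    (t : LieSubalgebra k q) [t.IsCartanSubalgebra]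
    -- a system of positive roots
    (Δplus : Finset (Module.Dual k ↥t))
    (hroots : ∀ α ∈ Δplus, α ≠ 0 ∧ rootSpace t ⇑α ≠ ⊥)
    (hpos : ∀ γ : Module.Dual k ↥t, γ ≠ 0 → rootSpace t ⇑γ ≠ ⊥ → (γ ∈ Δplus ∨ -γ ∈ Δplus))
    (hdisj : ∀ α ∈ Δplus, -α ∉ Δplus)
    (hclosed : ∀ α ∈ Δplus, ∀ β ∈ Δplus, rootSpace t ⇑(α + β) ≠ ⊥ → α + β ∈ Δplus)
    -- the simple roots: the indecomposable positive roots
    (Pi : Finset (Module.Dual k ↥t)) (hPipos : Pi ⊆ Δplus)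
    (hPi : ∀ α ∈ Δplus, (α ∈ Pi ↔ ¬∃ β ∈ Δplus, ∃ γ ∈ Δplus, α = β + γ))
    -- a principal sl₂-triple adapted to the simple roots
    (E F : Module.Dual k ↥t → q)
    (hE : ∀ α ∈ Pi, E α ∈ rootSpace t ⇑α ∧ E α ≠ 0)
    (hF : ∀ α ∈ Pi, F α ∈ rootSpace t ⇑(-α) ∧ F α ≠ 0)
    (e f : q) (he : e = ∑ α ∈ Pi, E α) (hf : f = ∑ α ∈ Pi, F α)
    (h : ↥t) (hhe : ⁅(h : q), e⁆ = (2 : k) • e) (hhf : ⁅(h : q), f⁆ = (-2 : k) • f)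
    (hef : ⁅e, f⁆ = (h : q))
    -- `ν` a simple root and `h'` a generic point of the hyperplane `H_ν`
    (ν : Module.Dual k ↥t) (hνPi : ν ∈ Pi)
    (h' : ↥t) (hh'ν : ν h' = 0)
    (hgen : ∀ γ : Module.Dual k ↥t, γ ≠ 0 → rootSpace t ⇑γ ≠ ⊥ →
      γ ≠ ν → γ ≠ -ν → γ h' ≠ 0)
    (s : k) (hs : s ≠ 0) :
    -- `h' + s·f` is regular …
    Module.finrank k ↥(LinearMap.ker ((LieAlgebra.ad k q) ((h' : q) + s • f)))
        = Module.finrank k ↥t ∧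
    -- … and its centralizer lies in `H_ν ⊕ u⁻`
    LinearMap.ker ((LieAlgebra.ad k q) ((h' : q) + s • f))
      ≤ (LinearMap.ker ν).map t.incl.toLinearMap
          ⊔ ⨆ α ∈ Δplus, (rootSpace t ⇑(-α)).toSubmodule := by
  have hF₁ : ∀ α ∈ Pi, F α ∈ rootSpace t ⇑(-α) := fun α hα ↦ (hF α hα).1
  have hν0 : ν ≠ 0 := (hroots ν (hPipos hνPi)).1
  have hνne : ∀ α ∈ Δplus, ∀ β ∈ Pi, α + β ≠ ν := fun α hα β hβ heq ↦
    (hPi ν (hPipos hνPi)).mp hνPi ⟨α, hα, β, hPipos hβ, heq.symm⟩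
  have hadd : ∀ α ∈ Δplus, ∀ β ∈ Pi, α + β ∉ Δplus → rootSpace t ⇑(α + β) = ⊥ :=
    fun α hα β hβ hn ↦ not_not.mp fun h₀ ↦ hn (hclosed α hα β (hPipos hβ) h₀)
  have hαh' : ∀ α ∈ Δplus, α ≠ ν → α h' ≠ 0 := fun α hα hne ↦
    hgen α (hroots α hα).1 (hroots α hα).2 hne
      (by rintro rfl; exact hdisj ν (hPipos hνPi) hα)
  have hh2 : ∀ α ∈ Pi, α h = 2 := by
    intro α hα
    have h₁ := congrArg (rootProj t (-α)) hhf
    rw [rootProj_coe_lie, map_smul, hf, rootProj_neg_sum hF₁ hα] at h₁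
    simpa using smul_left_injective k (hF α hα).2 h₁
  have hind {P : Module.Dual k t → Prop} := finset_add_induction Δplus Pi
    (LinearMap.toAddMonoidHom (Module.Dual.eval k t h)) two_ne_zero hh2 (P := P)
  subst hf
  have hcomp := rootProj_lie_add_smul_sum hF₁ h' s
  set x : q := (h' : q) + s • ∑ α ∈ Pi, F α with hx
  set U : Submodule k q := ⨆ α ∈ Δplus, (rootSpace t ⇑(-α)).toSubmodule with hU
  have hUmem : ∀ α ∈ Δplus, (rootSpace t ⇑(-α)).toSubmodule ≤ U := fun α hα ↦
    le_iSup₂_of_le α hα le_rfl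
  -- the centralizer has no components along positive roots
  have hker : LinearMap.ker (ad k q x) ≤ (LinearMap.ker ν).map t.incl.toLinearMap ⊔ U := by
    intro y hy
    have hxy : ⁅x, y⁆ = 0 := by simpa using hy
    replace hcomp γ := (hcomp γ y).symm.trans (by rw [hxy, map_zero])
    have hpos₀ : ∀ α ∈ Δplus, α ≠ ν → rootProj t α y = 0 := by
      refine hind fun α hα ih hne ↦ ?_
      have h₁ := hcomp α
      rw [Finset.sum_eq_zero, smul_zero, add_zero] at h₁
      · exact (smul_eq_zero.mp h₁).resolve_left (hαh' α hα hne)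
      · intro β hβ
        by_cases hmem : α + β ∈ Δplus
        · rw [ih β hβ hmem (hνne α hα β hβ), lie_zero]
        · rw [rootProj_eq_zero_of_eq_bot (hadd α hα β hβ hmem), lie_zero]
    have hν₀ : rootProj t ν y = 0 := by
      by_contra hne
      have h₁ := hcomp 0
      rw [Finset.sum_eq_single_of_mem ν hνPi] at h₁
      · simp only [LinearMap.zero_apply, zero_smul, zero_add, smul_eq_zero, hs, false_or] at h₁
        refine lie_ne_zero_of_mem_rootSpace_neg hν0 (rootProj_mem ν y) hne (hF ν hνPi).1
          (hF ν hνPi).2 ?_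
        rw [← lie_skew, h₁, neg_zero]
      · intro β hβ hne
        rw [zero_add, hpos₀ β (hPipos hβ) hne, lie_zero]
    have h₀ : rootProj t 0 y ∈ t := mem_of_mem_rootSpace_zero (rootProj_mem 0 y)
    have hker₀ : ν ⟨_, h₀⟩ = 0 := by
      have h₁ := hcomp (-ν)
      rw [Finset.sum_eq_single_of_mem ν hνPi] at h₁
      · rw [LinearMap.neg_apply, hh'ν, neg_zero, zero_smul, zero_add, neg_add_cancel, ← lie_skew,
          lie_eq_smul_of_mem_rootSpace_dual (hF ν hνPi).1 ⟨_, h₀⟩] at h₁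
        simpa [hs, (hF ν hνPi).2] using h₁
      · intro β hβ hne
        by_cases hbot : rootSpace t ⇑(-ν + β) = ⊥
        · rw [rootProj_eq_zero_of_eq_bot hbot, lie_zero]
        exfalso
        rcases hpos _ (fun h₁ ↦ hne (neg_add_eq_zero.mp h₁).symm) hbot with hmem | hmem
        · exact (hPi β (hPipos hβ)).mp hβ ⟨ν, hPipos hνPi, _, hmem, by abel⟩
        · exact (hPi ν (hPipos hνPi)).mp hνPi ⟨β, hPipos hβ, _, hmem, by abel⟩
    refine mem_of_rootProj_mem (t := t) fun γ ↦ ?_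
    by_cases hγ : γ = 0
    · subst hγ
      exact Submodule.mem_sup_left ⟨⟨_, h₀⟩, hker₀, rfl⟩
    by_cases hbot : rootSpace t ⇑γ = ⊥
    · rw [rootProj_eq_zero_of_eq_bot hbot]
      exact zero_mem _
    rcases hpos γ hγ hbot with hmem | hmem
    · by_cases hγν : γ = ν
      · rw [hγν, hν₀]
        exact zero_mem _
      · rw [hpos₀ γ hmem hγν]
        exact zero_mem _
    · have := rootProj_mem γ y
      rw [← neg_neg γ] at this
      refine Submodule.mem_sup_right (hUmem _ hmem ?_)
      rwa [neg_neg] at this ⊢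
  refine ⟨?_, hker⟩
  let A := ad k q x
  let b : Submodule k q := t.toSubmodule ⊔ U
  have hFU : ∀ α ∈ Pi, F α ∈ U := fun α hα ↦ hUmem α (hPipos hα) (hF₁ α hα)
  have hlieF : ∀ α ∈ Δplus, ∀ β ∈ Pi, ∀ z ∈ rootSpace t ⇑(-α), ⁅F β, z⁆ ∈ U ∧
      (α + β ∉ Δplus → ⁅F β, z⁆ = 0) ∧ ⁅F β, z⁆ ∈ rootSpace t ⇑(-(α + β)) := by
    intro α hα β hβ z hz
    have hm : ⁅F β, z⁆ ∈ rootSpace t ⇑(-(α + β)) := by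
      rw [neg_add_rev]
      exact lie_mem_genWeightSpace_of_mem_genWeightSpace (hF₁ β hβ) hz
    have h₀ : α + β ∉ Δplus → ⁅F β, z⁆ = 0 := by
      intro hmem
      by_contra hne
      refine rootSpace_neg_ne_bot (t := t) (γ := -(α + β))
        (fun h₁ ↦ hne (by rwa [h₁, LieSubmodule.mem_bot] at hm)) ?_
      rw [neg_neg]
      exact hadd α hα β hβ hmem
    refine ⟨?_, h₀, hm⟩
    by_cases hmem : α + β ∈ Δplus
    · exact hUmem _ hmem hm
    · rw [h₀ hmem]
      exact zero_mem _
  have hAt : ∀ u : t, A u = s • ∑ β ∈ Pi, β u • F β := by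
    intro u
    have h₁ : ⁅(h' : q), (u : q)⁆ = 0 := by
      rw [← LieSubalgebra.coe_bracket, trivial_lie_zero, ZeroMemClass.coe_zero]
    simp only [A, ad_apply, hx, add_lie, smul_lie, sum_lie, h₁, zero_add]
    congr 1
    refine Finset.sum_congr rfl fun β hβ ↦ ?_
    rw [← lie_skew, lie_eq_smul_of_mem_rootSpace_dual (hF₁ β hβ), LinearMap.neg_apply, neg_smul,
      neg_neg]
  have hAneg : ∀ α ∈ Δplus, ∀ z ∈ rootSpace t ⇑(-α),
      A z = -(α h' • z) + s • ∑ β ∈ Pi, ⁅F β, z⁆ := by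
    intro α hα z hz
    simp only [A, ad_apply, hx, add_lie, smul_lie, sum_lie]
    rw [lie_eq_smul_of_mem_rootSpace_dual hz, LinearMap.neg_apply, neg_smul]
  have hAb : ∀ z ∈ b, A z ∈ b.map A := fun z hz ↦ Submodule.mem_map_of_mem hz
  have hUb : U ≤ b := le_sup_right
  have hle : b.map A ≤ U := by
    rw [Submodule.map_le_iff_le_comap]
    refine sup_le (fun u hu ↦ ?_) (iSup₂_le fun α hα z hz ↦ ?_)
    · rw [Submodule.mem_comap, hAt ⟨u, hu⟩]
      exact U.smul_mem _ (sum_mem fun β hβ ↦ U.smul_mem _ (hFU β hβ))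
    · rw [Submodule.mem_comap, hAneg α hα z hz]
      exact add_mem (neg_mem (U.smul_mem _ (hUmem α hα hz)))
        (U.smul_mem _ (sum_mem fun β hβ ↦ (hlieF α hα β hβ z hz).1))
  have hmem₁ : ∀ α ∈ Δplus, α ≠ ν → (rootSpace t ⇑(-α)).toSubmodule ≤ b.map A := by
    refine hind fun α hα ih hne z hz ↦ ?_
    have hz' : α h' • z = s • ∑ β ∈ Pi, ⁅F β, z⁆ - A z := by
      rw [hAneg α hα z hz]
      abel
    rw [← inv_smul_smul₀ (hαh' α hα hne) z, hz']
    refine Submodule.smul_mem _ _ (sub_mem (Submodule.smul_mem _ _ (sum_mem fun β hβ ↦ ?_))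
      (hAb z (hUb (hUmem α hα hz))))
    obtain ⟨-, hz₀, hm⟩ := hlieF α hα β hβ z hz
    by_cases hmem : α + β ∈ Δplus
    · exact ih β hβ hmem (hνne α hα β hβ) hm
    · rw [hz₀ hmem]
      exact zero_mem _
  have hFν : F ν ∈ b.map A := by
    classical
    obtain ⟨u, hu⟩ := LinearMap.surjective hν0 1
    have h₁ := hAt u
    rw [← Finset.add_sum_erase _ _ hνPi, hu, one_smul, smul_add, ← sub_eq_iff_eq_add] at h₁
    rw [← inv_smul_smul₀ hs (F ν), ← h₁]
    refine Submodule.smul_mem _ _ (sub_mem (hAb _ (le_sup_left (a := t.toSubmodule) u.2))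
      (Submodule.smul_mem _ _ (sum_mem fun β hβ ↦ Submodule.smul_mem _ _ ?_)))
    obtain ⟨hne, hβ⟩ := Finset.mem_erase.mp hβ
    exact hmem₁ β (hPipos hβ) hne (hF₁ β hβ)
  have hmap : b.map A = U := by
    refine le_antisymm hle (iSup₂_le fun α hα ↦ ?_)
    by_cases hne : α = ν
    · subst hne
      intro z hz
      obtain ⟨c, rfl⟩ := exists_eq_smul_of_mem_rootSpace (neg_ne_zero.mpr hν0) (hF₁ α hνPi)
        (hF α hνPi).2 hz
      exact Submodule.smul_mem _ _ hFν
    · exact hmem₁ α hα hne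
  have hdisjoint : t.toSubmodule ⊓ U = ⊥ := by
    refine disjoint_iff.mp (Submodule.disjoint_def.mpr fun z hzt hzU ↦ ?_)
    have hU₀ : U ≤ LinearMap.ker (rootProj t (0 : Module.Dual k t)) :=
      iSup₂_le fun α hα w hw ↦ rootProj_of_mem_ne hw (neg_ne_zero.mpr (hroots α hα).1)
    exact (rootProj_of_mem (coe_mem_rootSpace_zero ⟨z, hzt⟩)).symm.trans (hU₀ hzU)
  have hkerb : LinearMap.ker A ≤ b := by
    refine hker.trans (sup_le_sup_right ?_ U)
    rintro _ ⟨u, -, rfl⟩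
    exact u.2
  have hrank := LinearMap.finrank_range_add_finrank_ker (A.domRestrict b)
  rw [LinearMap.range_domRestrict, hmap, LinearMap.ker_domRestrict,
    (Submodule.comapSubtypeEquivOfLe hkerb).finrank_eq] at hrank
  have hsum := Submodule.finrank_sup_add_finrank_inf_eq t.toSubmodule U
  rw [hdisjoint, finrank_bot, add_zero] at hsum
  change Module.finrank k b = _ at hsum
  exact Nat.add_left_cancel (hrank.trans (hsum.trans (add_comm _ _)))

end PoissonLie
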